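/- Let a, c be real numbers with a > 2 and c > 2 which are not positive integers, and write S(q) := ζ'(0,q) + ζ'(0,1−q), where ζ'(0,q) denotes the derivative of the Hurwitz zeta function ζ(z,q) with respect to z evaluated at z = 0. Then (1−a) ∫₀¹ ζ(2−a,q) ζ(1−c,q) S(q) dq + (1−a) ∫₀¹ ζ(2−a,q) ζ(1−c,1−q) S(q) dq + (1−c) ∫₀¹ ζ(1−a,q) ζ(2−c,q) S(q) dq − (1−c) ∫₀¹ ζ(1−a,q) ζ(2−c,1−q) S(q) dq = −π ∫₀¹ ζ(1−c,q) ( ζ(1−a,q) − ζ(1−a,1−q) ) cot(πq) dq. -/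

import Mathlib

open Real MeasureTheory

/-- Hurwitz zeta as a real-valued function of real arguments. -/
noncomputable def hzeta (z q : ℝ) : ℝ := (HurwitzZeta.hurwitzZeta (q : UnitAddCircle) (z : ℂ)).re

/-- `ζ'(0,q)`: the `z`-derivative of the Hurwitz zeta function at `z = 0`. -/
noncomputable def hzetaDerivZero (q : ℝ) : ℝ :=
  (deriv (fun z : ℂ => HurwitzZeta.hurwitzZeta (q : UnitAddCircle) z) 0).re

/-- `S(q) = ζ'(0,q) + ζ'(0,1-q)`. -/
noncomputable def S (q : ℝ) : ℝ := hzetaDerivZero q + hzetaDerivZero (1 - q)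

open Filter Topology Set

lemma one_sub_mul_exp_neg_mem_slitPlane {w : ℂ} (hw : ‖w‖ = 1) (hw1 : w ≠ 1) {t : ℝ}
    (ht : 0 ≤ t) : 1 - w * (Real.exp (-t) : ℂ) ∈ Complex.slitPlane := by
  left
  have hre : w.re < 1 := by
    refine lt_of_le_of_ne (hw ▸ Complex.re_le_norm w) fun h => hw1 ?_
    have h2 : w.re ^ 2 + w.im ^ 2 = 1 := by
      have := Complex.sq_norm w
      rw [hw, Complex.normSq_apply] at this
      linarith
    have h3 : w.im = 0 := by nlinarith
    exact Complex.ext h h3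
  have hE : Real.exp (-t) ≤ 1 := Real.exp_le_one_iff.mpr (by linarith)
  have hE0 := Real.exp_pos (-t)
  simp only [Complex.sub_re, Complex.one_re, Complex.mul_re, Complex.ofReal_re,
    Complex.ofReal_im, mul_zero, sub_zero]
  rcases le_or_gt w.re 0 with h | h <;> nlinarith

/-- The generating function `∑ n ≥ 1, w ^ n * exp (-n * t)`. -/
noncomputable def expGeometric (w : ℂ) (t : ℝ) : ℂ :=
  w * (Real.exp (-t) : ℂ) / (1 - w * (Real.exp (-t) : ℂ))

lemma continuousOn_expGeometric {w : ℂ} (hw : ‖w‖ = 1) (hw1 : w ≠ 1) :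
    ContinuousOn (expGeometric w) (Ici 0) := by
  unfold expGeometric
  refine ContinuousOn.div (by fun_prop) (by fun_prop) fun t ht => ?_
  exact Complex.slitPlane_ne_zero (one_sub_mul_exp_neg_mem_slitPlane hw hw1 ht)

lemma hasDerivAt_log_one_sub_mul_exp_neg {w : ℂ} (hw : ‖w‖ = 1) (hw1 : w ≠ 1) {t : ℝ}
    (ht : 0 ≤ t) :
    HasDerivAt (fun t : ℝ => Complex.log (1 - w * (Real.exp (-t) : ℂ))) (expGeometric w t) t := by
  have h1 : HasDerivAt (fun t : ℝ => Real.exp (-t)) (-Real.exp (-t)) t := by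
    simpa using (hasDerivAt_neg t).exp
  have h2 := (h1.ofReal_comp.const_mul w).const_sub 1
  convert h2.clog_real (one_sub_mul_exp_neg_mem_slitPlane hw hw1 ht) using 1
  simp [expGeometric]

lemma expGeometric_isBigO {w : ℂ} (hw : ‖w‖ = 1) :
    expGeometric w =O[atTop] fun t => Real.exp (-1 * t) := by
  refine Asymptotics.IsBigO.of_bound 2 ?_
  filter_upwards [eventually_ge_atTop (1 : ℝ)] with t ht
  have hE : Real.exp (-t) ≤ 1 / 2 := by
    rw [Real.exp_neg, one_div]
    exact inv_anti₀ (by norm_num) (by linarith [Real.add_one_le_exp t])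
  have hE0 := Real.exp_pos (-t)
  have hn : ‖w * (Real.exp (-t) : ℂ)‖ = Real.exp (-t) := by
    rw [norm_mul, hw, one_mul, Complex.norm_real, Real.norm_of_nonneg hE0.le]
  have hd : 1 / 2 ≤ ‖1 - w * (Real.exp (-t) : ℂ)‖ := by
    have := norm_sub_norm_le 1 (w * (Real.exp (-t) : ℂ))
    rw [hn, norm_one] at this
    linarith
  rw [expGeometric, norm_div, hn, neg_one_mul, Real.norm_of_nonneg hE0.le,
    div_le_iff₀ (by linarith)]
  nlinarith

lemma hasSum_expGeometric {w : ℂ} (hw : ‖w‖ = 1) {t : ℝ} (ht : 0 < t) :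
    HasSum (fun n : ℕ => w ^ (n + 1) * (Real.exp (-((n : ℝ) + 1) * t) : ℂ))
      (expGeometric w t) := by
  have hn : ‖w * (Real.exp (-t) : ℂ)‖ < 1 := by
    rw [norm_mul, hw, one_mul, Complex.norm_real, Real.norm_of_nonneg (Real.exp_pos _).le]
    exact Real.exp_lt_one_iff.2 (by linarith)
  refine ((hasSum_geometric_of_norm_lt_one hn).mul_left (w * (Real.exp (-t) : ℂ))).congr_fun
    fun n => ?_
  rw [← pow_succ', mul_pow, ← Complex.ofReal_pow, ← Real.exp_nat_mul]
  congr 3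
  push_cast
  ring

lemma integral_expGeometric {w : ℂ} (hw : ‖w‖ = 1) (hw1 : w ≠ 1) :
    ∫ t in Ioi (0 : ℝ), expGeometric w t = -Complex.log (1 - w) := by
  have hint : IntegrableOn (expGeometric w) (Ioi 0) :=
    (integrableOn_Ici_iff_integrableOn_Ioi (by finiteness)).mp <|
      ((continuousOn_expGeometric hw hw1).locallyIntegrableOn
        measurableSet_Ici).integrableOn_of_isBigO_atTop (expGeometric_isBigO hw)
        ⟨Ioi 1, Ioi_mem_atTop 1, exp_neg_integrableOn_Ioi 1 one_pos⟩
  have hlim : Tendsto (fun t : ℝ => Complex.log (1 - w * (Real.exp (-t) : ℂ))) atTop (𝓝 0) := by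
    have h1 : Tendsto (fun t : ℝ => 1 - w * (Real.exp (-t) : ℂ)) atTop (𝓝 1) := by
      have := (Complex.continuous_ofReal.tendsto 0).comp Real.tendsto_exp_neg_atTop_nhds_zero
      simpa using (this.const_mul w).const_sub 1
    simpa using h1.clog (by simp)
  simpa using integral_Ioi_of_hasDerivAt_of_tendsto'
    (fun t ht => hasDerivAt_log_one_sub_mul_exp_neg hw hw1 ht) hint hlim

lemma norm_exp_two_pi_I_mul (q : ℝ) : ‖Complex.exp (2 * π * Complex.I * q)‖ = 1 := by
  rw [show 2 * (π : ℂ) * Complex.I * q = ((2 * π * q : ℝ) : ℂ) * Complex.I by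
    push_cast; ring]
  exact Complex.norm_exp_ofReal_mul_I _

lemma Gamma_mul_expZeta (q : ℝ) {s : ℂ} (hs : 1 < s.re) :
    Complex.Gamma s * HurwitzZeta.expZeta q s =
      mellin (expGeometric (Complex.exp (2 * π * Complex.I * q))) s := by
  set w := Complex.exp (2 * π * Complex.I * q) with hwdef
  have hw : ‖w‖ = 1 := norm_exp_two_pi_I_mul q
  have hm := hasSum_mellin (a := fun n : ℕ => w ^ (n + 1)) (p := fun n : ℕ => (n : ℝ) + 1)
    (F := expGeometric w) (s := s) (fun n => Or.inr (by positivity)) (by linarith)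
    (fun t ht => hasSum_expGeometric hw ht) (by
      simp only [norm_pow, hw, one_pow]
      exact_mod_cast (summable_nat_add_iff 1).mpr (Real.summable_one_div_nat_rpow.mpr hs))
  have hz := HurwitzZeta.hasSum_expZeta_of_one_lt_re q hs
  rw [← hasSum_nat_add_iff' 1] at hz
  have hs0 : s ≠ 0 := by rintro rfl; simp at hs; linarith
  simp only [Finset.range_one, Finset.sum_singleton, Nat.cast_zero,
    Complex.zero_cpow hs0, div_zero, sub_zero] at hz
  refine (hz.mul_left (Complex.Gamma s)).unique ?_
  refine hm.congr_fun fun n => ?_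
  rw [hwdef, ← Complex.exp_nat_mul, mul_div_assoc]
  push_cast
  congr 3
  ring

lemma norm_one_sub_exp_two_pi_I_mul (q : ℝ) :
    ‖1 - Complex.exp (2 * π * Complex.I * q)‖ = |2 * Real.sin (π * q)| := by
  rw [norm_sub_rev, show 2 * (π : ℂ) * Complex.I * q = Complex.I * ((2 * π * q : ℝ) : ℂ) by
    push_cast; ring, Complex.norm_exp_I_mul_ofReal_sub_one, Real.norm_eq_abs]
  congr 3
  ring

lemma sin_pi_mul_pos {q : ℝ} (hq : q ∈ Ioo (0 : ℝ) 1) : 0 < Real.sin (π * q) :=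
  Real.sin_pos_of_pos_of_lt_pi (by have := hq.1; positivity)
    (by nlinarith [hq.2, Real.pi_pos])

lemma coe_unitAddCircle_ne_zero {q : ℝ} (hq : q ∈ Ioo (0 : ℝ) 1) : (q : UnitAddCircle) ≠ 0 := by
  rw [Ne, AddCircle.coe_eq_zero_iff_of_mem_Ico (Ioo_subset_Ico_self hq)]
  exact hq.1.ne'

lemma coe_one_sub (q : ℝ) : ((1 - q : ℝ) : UnitAddCircle) = -(q : UnitAddCircle) := by
  rw [AddCircle.coe_sub, AddCircle.coe_period, zero_sub]

lemma expZeta_one {q : ℝ} (hq : q ∈ Ioo (0 : ℝ) 1) :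
    HurwitzZeta.expZeta q 1 = -Complex.log (1 - Complex.exp (2 * π * Complex.I * q)) := by
  have hw1 : Complex.exp (2 * π * Complex.I * q) ≠ 1 := by
    intro h
    have := norm_one_sub_exp_two_pi_I_mul q
    rw [h, sub_self, norm_zero, eq_comm, abs_eq_zero] at this
    linarith [sin_pi_mul_pos hq]
  have hfun := fun (s : ℂ) (hs : 1 < s.re) => Gamma_mul_expZeta q hs
  have hw := norm_exp_two_pi_I_mul q
  set w := Complex.exp (2 * π * Complex.I * q)
  have hcont := continuousOn_expGeometric hw hw1
  have hbot : expGeometric w =O[𝓝[>] 0] fun t : ℝ => t ^ (-(0 : ℝ)) := by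
    simp only [neg_zero, Real.rpow_zero]
    exact ((hcont 0 self_mem_Ici).mono Ioi_subset_Ici_self).isBigO_one ℝ
  have hmell : ContinuousAt (mellin (expGeometric w)) 1 :=
    (mellin_differentiableAt_of_isBigO_rpow_exp one_pos
      ((hcont.mono Ioi_subset_Ici_self).locallyIntegrableOn measurableSet_Ioi)
      (expGeometric_isBigO hw) hbot (by simp)).continuousAt
  have hleft : ContinuousAt (fun s => Complex.Gamma s * HurwitzZeta.expZeta q s) 1 :=
    Complex.continuousAt_Gamma_one.mul (HurwitzZeta.differentiableAt_expZeta q 1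
      (Or.inr (coe_unitAddCircle_ne_zero hq))).continuousAt
  have hco : Tendsto (fun x : ℝ => (x : ℂ)) (𝓝[>] 1) (𝓝 1) :=
    (Complex.continuous_ofReal.tendsto' 1 1 Complex.ofReal_one).mono_left nhdsWithin_le_nhds
  have heq : (fun x : ℝ => Complex.Gamma x * HurwitzZeta.expZeta q x) =ᶠ[𝓝[>] 1]
      fun x : ℝ => mellin (expGeometric w) x := by
    filter_upwards [self_mem_nhdsWithin] with x hx
    exact hfun x (by simpa using hx)
  have := tendsto_nhds_unique ((hleft.tendsto.comp hco).congr' heq) (hmell.tendsto.comp hco)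
  rw [Complex.Gamma_one, one_mul] at this
  rw [this, ← integral_expGeometric hw hw1]
  simp [mellin]

lemma re_cosZeta_one {q : ℝ} (hq : q ∈ Ioo (0 : ℝ) 1) :
    (HurwitzZeta.cosZeta q 1).re = -Real.log (2 * Real.sin (π * q)) := by
  have hq' : 1 - q ∈ Ioo (0 : ℝ) 1 := ⟨by linarith [hq.2], by linarith [hq.1]⟩
  have hs : Real.sin (π * (1 - q)) = Real.sin (π * q) := by
    rw [mul_sub, mul_one, Real.sin_pi_sub]
  have h1 := expZeta_one hq'
  rw [coe_one_sub] at h1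
  rw [HurwitzZeta.cosZeta_eq, expZeta_one hq, h1, Complex.div_ofNat_re, Complex.add_re,
    Complex.neg_re,
    Complex.neg_re, Complex.log_re, Complex.log_re, norm_one_sub_exp_two_pi_I_mul,
    norm_one_sub_exp_two_pi_I_mul, hs, Real.log_abs]
  ring

lemma deriv_hurwitzZetaEven_zero {a : UnitAddCircle} (ha : a ≠ 0) :
    deriv (HurwitzZeta.hurwitzZetaEven a) 0 = HurwitzZeta.cosZeta a 1 / 2 := by
  set K : ℂ → ℂ := fun s => 2 * (2 * π) ^ (-s) * Complex.Gamma s * HurwitzZeta.cosZeta a s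
  have hKd : DifferentiableAt ℂ K 1 := by
    have h1 : DifferentiableAt ℂ (fun s : ℂ => (2 * π : ℂ) ^ (-s)) 1 :=
      differentiableAt_id.neg.const_cpow (Or.inl (by simp [Real.pi_ne_zero]))
    exact ((h1.const_mul 2).mul Complex.differentiableAt_Gamma_one).mul
      (HurwitzZeta.differentiableAt_cosZeta a (Or.inr ha))
  have hcos : HasDerivAt (fun s : ℂ => Complex.cos (π * s / 2)) (-(π / 2)) 1 := by
    have h := (((hasDerivAt_id (1 : ℂ)).const_mul (π : ℂ)).div_const 2).ccos
    simpa using h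
  have hprod := hKd.hasDerivAt.mul hcos
  have hcomp := hprod.scomp_of_eq (0 : ℂ) ((hasDerivAt_id' (0 : ℂ)).const_sub 1) (by simp)
  have hev : HurwitzZeta.hurwitzZetaEven a =ᶠ[𝓝 0]
      (K * fun s : ℂ => Complex.cos (π * s / 2)) ∘ fun s => 1 - s := by
    have hre : ∀ᶠ s : ℂ in 𝓝 0, 0 < (1 - s).re :=
      ContinuousAt.eventually_lt (by fun_prop) (by fun_prop) (by simp)
    filter_upwards [hre] with s hs
    have h := HurwitzZeta.hurwitzZetaEven_one_sub a (s := 1 - s)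
      (fun n hn => by
        rw [hn] at hs
        simp at hs
        linarith [n.cast_nonneg (α := ℝ)]) (Or.inl ha)
    rw [sub_sub_cancel] at h
    rw [h]
    simp only [K, Function.comp_apply, Pi.mul_apply]
    ring
  rw [hev.deriv_eq, hcomp.deriv]
  simp only [K]
  simp [Complex.cpow_neg_one]
  field_simp

lemma S_eq_neg_log {q : ℝ} (hq : q ∈ Ioo (0 : ℝ) 1) :
    S q = -Real.log (2 * Real.sin (π * q)) := by
  have hd (a : UnitAddCircle) : DifferentiableAt ℂ (HurwitzZeta.hurwitzZeta a) 0 :=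
    HurwitzZeta.differentiableAt_hurwitzZeta a zero_ne_one
  have h := deriv_hurwitzZetaEven_zero (coe_unitAddCircle_ne_zero hq)
  have hE : HurwitzZeta.hurwitzZetaEven q = fun s =>
      (HurwitzZeta.hurwitzZeta q s + HurwitzZeta.hurwitzZeta (-q) s) / 2 :=
    funext (HurwitzZeta.hurwitzZetaEven_eq q)
  rw [hE, deriv_div_const, deriv_fun_add (hd _) (hd _), div_left_inj' two_ne_zero] at h
  rw [S, hzetaDerivZero, hzetaDerivZero, coe_one_sub, ← Complex.add_re, ← re_cosZeta_one hq, ← h]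

lemma norm_expZeta_term_le (q : ℝ) {s : ℝ} (hs : s ≠ 0) (n : ℕ) :
    ‖Complex.exp (2 * π * Complex.I * q * n) / (n : ℂ) ^ (s : ℂ)‖ ≤ 1 / (n : ℝ) ^ s := by
  rcases n.eq_zero_or_pos with rfl | h
  · simp [Complex.zero_cpow (Complex.ofReal_ne_zero.mpr hs), Real.zero_rpow hs]
  · have h1 := norm_exp_two_pi_I_mul (q * n)
    rw [Complex.ofReal_mul, Complex.ofReal_natCast, ← mul_assoc] at h1
    rw [norm_div, h1, Complex.norm_natCast_cpow_of_pos h, Complex.ofReal_re]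

lemma expZeta_eq_tsum (q : ℝ) {s : ℝ} (hs : 1 < s) : HurwitzZeta.expZeta q s =
    ∑' n : ℕ, Complex.exp (2 * π * Complex.I * q * n) / (n : ℂ) ^ (s : ℂ) :=
  (HurwitzZeta.hasSum_expZeta_of_one_lt_re q (by simpa using hs)).tsum_eq.symm

lemma continuous_expZeta {s : ℝ} (hs : 1 < s) :
    Continuous fun q : ℝ => HurwitzZeta.expZeta q s := by
  simp_rw [expZeta_eq_tsum _ hs]
  exact continuous_tsum (fun n => by fun_prop) (Real.summable_one_div_nat_rpow.mpr hs)
    fun n q => norm_expZeta_term_le q (by linarith) n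

lemma hasDerivAt_expZeta_term {s : ℝ} (hs : 1 < s) (n : ℕ) (q : ℝ) :
    HasDerivAt (fun q : ℝ => Complex.exp (2 * π * Complex.I * q * n) / (n : ℂ) ^ (s : ℂ))
      (2 * π * Complex.I *
        (Complex.exp (2 * π * Complex.I * q * n) / (n : ℂ) ^ ((s - 1 : ℝ) : ℂ))) q := by
  have h : HasDerivAt (fun q : ℝ => Complex.exp (2 * π * Complex.I * q * n) / (n : ℂ) ^ (s : ℂ))
      (Complex.exp (2 * π * Complex.I * q * n) * (2 * π * Complex.I * 1 * n) /
        (n : ℂ) ^ (s : ℂ)) q :=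
    ((((hasDerivAt_id' q).ofReal_comp.const_mul (2 * π * Complex.I)).mul_const
      (n : ℂ)).cexp).div_const ((n : ℂ) ^ (s : ℂ))
  refine h.congr_deriv ?_
  rcases eq_or_ne n 0 with rfl | hn
  · rw [Nat.cast_zero, Complex.zero_cpow (x := ((s - 1 : ℝ) : ℂ))
      (Complex.ofReal_ne_zero.mpr (by linarith))]
    simp
  · have hn' : (n : ℂ) ≠ 0 := Nat.cast_ne_zero.mpr hn
    rw [Complex.ofReal_sub, Complex.ofReal_one, Complex.cpow_sub _ _ hn', Complex.cpow_one,
      div_div_eq_mul_div]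
    ring

lemma hasDerivAt_expZeta {s : ℝ} (hs : 2 < s) (q : ℝ) :
    HasDerivAt (fun q : ℝ => HurwitzZeta.expZeta q s)
      (2 * π * Complex.I * HurwitzZeta.expZeta q (s - 1 : ℝ)) q := by
  have hs1 : 1 < s - 1 := by linarith
  simp_rw [expZeta_eq_tsum _ (show 1 < s by linarith)]
  rw [expZeta_eq_tsum _ hs1, ← tsum_mul_left]
  refine hasDerivAt_tsum (u := fun n : ℕ => 2 * π * (1 / (n : ℝ) ^ (s - 1)))
    ((Real.summable_one_div_nat_rpow.mpr hs1).mul_left _)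
    (fun n y => hasDerivAt_expZeta_term (by linarith) n y) (fun n y => ?_)
    (HurwitzZeta.hasSum_expZeta_of_one_lt_re q
      (by rw [Complex.ofReal_re]; linarith)).summable q
  have hpi : ‖2 * (π : ℂ) * Complex.I‖ = 2 * π := by
    simp [abs_of_pos Real.pi_pos]
  rw [norm_mul, hpi]
  exact mul_le_mul_of_nonneg_left (norm_expZeta_term_le y (by linarith) n) (by positivity)

lemma hurwitzZeta_one_sub_ofReal (q : ℝ) {s : ℝ} (hs : 1 < s) :
    HurwitzZeta.hurwitzZeta q (1 - s : ℝ) = (2 * π) ^ (-s : ℂ) * Complex.Gamma s *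
      (Complex.exp (-π * Complex.I * s / 2) * HurwitzZeta.expZeta q s +
        Complex.exp (π * Complex.I * s / 2) * HurwitzZeta.expZeta (-q : ℝ) s) := by
  rw [Complex.ofReal_sub, Complex.ofReal_one, HurwitzZeta.hurwitzZeta_one_sub _
    (fun n hn => ?_) (Or.inr (by exact_mod_cast hs.ne')), AddCircle.coe_neg]
  have : s = -n := by exact_mod_cast hn
  linarith [n.cast_nonneg (α := ℝ)]

lemma continuous_hzeta {s : ℝ} (hs : 1 < s) : Continuous (hzeta (1 - s)) := by
  unfold hzeta
  simp_rw [hurwitzZeta_one_sub_ofReal _ hs]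
  have h1 := continuous_expZeta hs
  have h2 := h1.comp continuous_neg
  exact Complex.continuous_re.comp (continuous_const.mul
    ((continuous_const.mul h1).add (continuous_const.mul h2)))

lemma hasDerivAt_hzeta {s : ℝ} (hs : 2 < s) (q : ℝ) :
    HasDerivAt (hzeta (1 - s)) (-((1 - s) * hzeta (2 - s) q)) q := by
  have h1 := hasDerivAt_expZeta hs q
  have h2 := (hasDerivAt_expZeta hs (-q)).scomp q (hasDerivAt_neg q)
  have h := ((h1.const_mul (Complex.exp (-π * Complex.I * s / 2))).add
    (h2.const_mul (Complex.exp (π * Complex.I * s / 2)))).const_mul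
      ((2 * π) ^ (-s : ℂ) * Complex.Gamma s)
  have key : HasDerivAt (fun q : ℝ => HurwitzZeta.hurwitzZeta q (1 - s : ℝ))
      ((s - 1 : ℝ) * HurwitzZeta.hurwitzZeta q (2 - s : ℝ)) q := by
    simp_rw [hurwitzZeta_one_sub_ofReal _ (show 1 < s by linarith)]
    refine h.congr_deriv ?_
    rw [show 2 - s = 1 - (s - 1) by ring, hurwitzZeta_one_sub_ofReal _ (by linarith)]
    have hG : Complex.Gamma s = (s - 1 : ℂ) * Complex.Gamma (s - 1) := by
      have hne : (s : ℂ) - 1 ≠ 0 := by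
        rw [← Complex.ofReal_one, ← Complex.ofReal_sub]
        exact_mod_cast (by linarith : s - 1 ≠ 0)
      rw [← Complex.Gamma_add_one _ hne, sub_add_cancel]
    have hpi : (2 * π : ℂ) ≠ 0 := by simp [Real.pi_ne_zero]
    have e1 : Complex.exp (-π * Complex.I * (s - 1) / 2) =
        Complex.exp (-π * Complex.I * s / 2) * Complex.I := by
      rw [show -π * Complex.I * (s - 1) / 2 = -π * Complex.I * s / 2 + π / 2 * Complex.I by ring,
        Complex.exp_add, Complex.exp_pi_div_two_mul_I]
    have e2 : Complex.exp (π * Complex.I * (s - 1) / 2) =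
        Complex.exp (π * Complex.I * s / 2) * -Complex.I := by
      rw [show π * Complex.I * (s - 1) / 2 = π * Complex.I * s / 2 + -π / 2 * Complex.I by ring,
        Complex.exp_add, Complex.exp_neg_pi_div_two_mul_I]
    push_cast
    rw [hG, e1, e2, show -((s : ℂ) - 1) = -s + 1 by ring, Complex.cpow_add _ _ hpi,
      Complex.cpow_one]
    simp only [neg_smul, one_smul]
    ring
  refine (Complex.reCLM.hasFDerivAt.comp_hasDerivAt q key).congr_deriv ?_
  rw [Complex.reCLM_apply, Complex.re_ofReal_mul, hzeta]
  ring

/-- A `C¹` function vanishing at both ends of `[0, 1]` is bounded there by a multiple of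
`sin (π q)`. -/
lemma exists_abs_le_mul_sin {G G' : ℝ → ℝ} (hG : ∀ q, HasDerivAt G (G' q) q)
    (hG' : Continuous G') (h0 : G 0 = 0) (h1 : G 1 = 0) :
    ∃ M, ∀ q ∈ Ioo (0 : ℝ) 1, |G q| ≤ M * Real.sin (π * q) := by
  obtain ⟨K, hK⟩ := isCompact_Icc.exists_bound_of_continuousOn (s := Icc (0 : ℝ) 1)
    hG'.continuousOn
  have hK0 : 0 ≤ K := (norm_nonneg _).trans (hK 0 (by simp))
  have hlip : ∀ x ∈ Icc (0 : ℝ) 1, ∀ y ∈ Icc (0 : ℝ) 1, |G y - G x| ≤ K * |y - x| :=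
    fun x hx y hy => (convex_Icc (0 : ℝ) 1).norm_image_sub_le_of_norm_hasDerivWithin_le
      (fun z _ => (hG z).hasDerivWithinAt) hK hx hy
  refine ⟨K, fun q hq => ?_⟩
  have hq' : q ∈ Icc (0 : ℝ) 1 := Ioo_subset_Icc_self hq
  have hpi := Real.pi_pos
  rcases le_total q (1 / 2) with h | h
  · have hs := Real.mul_le_sin (x := π * q) (by nlinarith [hq.1]) (by nlinarith)
    have hG1 := hlip 0 (by simp) q hq'
    rw [h0, sub_zero, sub_zero, abs_of_pos hq.1] at hG1
    rw [← mul_assoc, div_mul_cancel₀ _ hpi.ne'] at hs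
    nlinarith [hq.1]
  · have hs := Real.mul_le_sin (x := π * (1 - q)) (by nlinarith [hq.2]) (by nlinarith)
    have hG1 := hlip 1 (by simp) q hq'
    rw [h1, sub_zero, abs_sub_comm q, abs_of_pos (sub_pos.mpr hq.2)] at hG1
    rw [← mul_assoc, div_mul_cancel₀ _ hpi.ne',
      show π * (1 - q) = π - π * q by ring, Real.sin_pi_sub] at hs
    nlinarith [hq.2]

lemma intervalIntegrable_mul_cot {G G' : ℝ → ℝ} (hG : ∀ q, HasDerivAt G (G' q) q)
    (hG' : Continuous G') (h0 : G 0 = 0) (h1 : G 1 = 0) :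
    IntervalIntegrable (fun q => G q * (Real.cos (π * q) / Real.sin (π * q))) volume 0 1 := by
  obtain ⟨M, hM⟩ := exists_abs_le_mul_sin hG hG' h0 h1
  have hGc : Continuous G := continuous_iff_continuousAt.mpr fun q => (hG q).continuousAt
  rw [intervalIntegrable_iff_integrableOn_Ioo_of_le zero_le_one]
  refine Measure.integrableOn_of_bounded (M := M) (by simp)
    (by have := hGc.measurable; exact (by fun_prop : Measurable _).aestronglyMeasurable) ?_
  refine (ae_restrict_iff' measurableSet_Ioo).mpr (Eventually.of_forall fun q hq => ?_)
  have hs := sin_pi_mul_pos hq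
  rw [Real.norm_eq_abs, abs_mul, abs_div, abs_of_pos hs, mul_div_assoc', div_le_iff₀ hs]
  exact (mul_le_of_le_one_right (abs_nonneg _) (Real.abs_cos_le_one _)).trans (hM q hq)

lemma intervalIntegrable_log_two_mul_sin_pi :
    IntervalIntegrable (fun q => Real.log (2 * Real.sin (π * q))) volume 0 1 := by
  have h : IntervalIntegrable (fun q => Real.log 2 + Real.log (Real.sin (π * q))) volume 0 1 := by
    refine intervalIntegrable_const.add ?_
    have := (intervalIntegrable_log_sin (a := 0) (b := π)).comp_mul_left (c := π)
    simpa [Real.pi_ne_zero] using this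
  refine h.congr_uIoo fun q hq => ?_
  rw [uIoo_of_le zero_le_one] at hq
  exact (Real.log_mul two_ne_zero (sin_pi_mul_pos hq).ne').symm

lemma integral_deriv_mul_log_two_mul_sin_pi {G G' : ℝ → ℝ} (hG : ∀ q, HasDerivAt G (G' q) q)
    (hG' : Continuous G') (h0 : G 0 = 0) (h1 : G 1 = 0) :
    ∫ q in (0 : ℝ)..1, G' q * Real.log (2 * Real.sin (π * q)) =
      -π * ∫ q in (0 : ℝ)..1, G q * (Real.cos (π * q) / Real.sin (π * q)) := by
  obtain ⟨M, hM⟩ := exists_abs_le_mul_sin hG hG' h0 h1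
  have hcot := (intervalIntegrable_mul_cot hG hG' h0 h1).const_mul π
  have hlog := intervalIntegrable_log_two_mul_sin_pi.continuousOn_mul hG'.continuousOn
  have hderiv : ∀ q ∈ Ioo (0 : ℝ) 1, HasDerivAt (fun q => G q * Real.log (2 * Real.sin (π * q)))
      (G' q * Real.log (2 * Real.sin (π * q)) +
        π * (G q * (Real.cos (π * q) / Real.sin (π * q)))) q := fun q hq => by
    have hs := (sin_pi_mul_pos hq).ne'
    have h := (hG q).mul (((((hasDerivAt_id q).const_mul π).sin).const_mul 2).log
      (mul_ne_zero two_ne_zero hs))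
    refine h.congr_deriv ?_
    simp only [id]
    field_simp
  have hbound : ∀ q ∈ Ioo (0 : ℝ) 1, ‖G q * Real.log (2 * Real.sin (π * q))‖ ≤
      M / 2 * |2 * Real.sin (π * q) * Real.log (2 * Real.sin (π * q))| := fun q hq => by
    have hs := sin_pi_mul_pos hq
    rw [Real.norm_eq_abs, abs_mul, abs_mul, abs_of_pos (mul_pos two_pos hs)]
    nlinarith [mul_le_mul_of_nonneg_right (hM q hq) (abs_nonneg (Real.log (2 * Real.sin (π * q))))]
  have hcont : Continuous fun q =>
      M / 2 * |2 * Real.sin (π * q) * Real.log (2 * Real.sin (π * q))| :=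
    continuous_const.mul (Real.continuous_mul_log.comp
      (by fun_prop : Continuous fun q => 2 * Real.sin (π * q))).abs
  have ha : Tendsto (fun q => G q * Real.log (2 * Real.sin (π * q))) (𝓝[>] 0) (𝓝 0) :=
    squeeze_zero_norm' (by filter_upwards [Ioo_mem_nhdsGT one_pos] with q hq using hbound q hq)
      ((hcont.tendsto' 0 0 (by simp)).mono_left nhdsWithin_le_nhds)
  have hb : Tendsto (fun q => G q * Real.log (2 * Real.sin (π * q))) (𝓝[<] 1) (𝓝 0) :=
    squeeze_zero_norm' (by filter_upwards [Ioo_mem_nhdsLT one_pos] with q hq using hbound q hq)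
      ((hcont.tendsto' 1 0 (by simp)).mono_left nhdsWithin_le_nhds)
  have := intervalIntegral.integral_eq_sub_of_hasDerivAt_of_tendsto one_pos hderiv
    (hlog.add hcot) ha hb
  rw [intervalIntegral.integral_add hlog hcot, intervalIntegral.integral_const_mul] at this
  linarith

lemma integral_mul_cot_eq_zero {H : ℝ → ℝ} (hH : ∀ q, H (1 - q) = H q) :
    ∫ q in (0 : ℝ)..1, H q * (Real.cos (π * q) / Real.sin (π * q)) = 0 := by
  have h := intervalIntegral.integral_comp_sub_left (a := 0) (b := 1)
    (fun q => H q * (Real.cos (π * q) / Real.sin (π * q))) 1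
  simp only [hH, mul_sub, mul_one, Real.cos_pi_sub, Real.sin_pi_sub, neg_div, mul_neg,
    intervalIntegral.integral_neg, sub_self, sub_zero] at h
  linarith

lemma hzeta_apply_one (z : ℝ) : hzeta z 1 = hzeta z 0 := by
  rw [hzeta, hzeta, AddCircle.coe_period, AddCircle.coe_zero]

theorem Nplus_minus_Nminus_identity (a c : ℝ) (ha : 2 < a) (hc : 2 < c)
    (ha' : ∀ k : ℕ, a ≠ k) (hc' : ∀ k : ℕ, c ≠ k) :
    (1 - a) * (∫ q in (0:ℝ)..1, hzeta (2 - a) q * hzeta (1 - c) q * S q)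
      + (1 - a) * (∫ q in (0:ℝ)..1, hzeta (2 - a) q * hzeta (1 - c) (1 - q) * S q)
      + (1 - c) * (∫ q in (0:ℝ)..1, hzeta (1 - a) q * hzeta (2 - c) q * S q)
      - (1 - c) * (∫ q in (0:ℝ)..1, hzeta (1 - a) q * hzeta (2 - c) (1 - q) * S q)
    = -π * ∫ q in (0:ℝ)..1,
        hzeta (1 - c) q * (hzeta (1 - a) q - hzeta (1 - a) (1 - q)) *
          (Real.cos (π * q) / Real.sin (π * q)) := by
  set A := hzeta (1 - a)
  set C := hzeta (1 - c)
  set A' : ℝ → ℝ := fun q => -((1 - a) * hzeta (2 - a) q)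
  set C' : ℝ → ℝ := fun q => -((1 - c) * hzeta (2 - c) q)
  have hA (q : ℝ) : HasDerivAt A (A' q) q := hasDerivAt_hzeta ha q
  have hC (q : ℝ) : HasDerivAt C (C' q) q := hasDerivAt_hzeta hc q
  have hAr (q : ℝ) : HasDerivAt (fun q => A (1 - q)) (-A' (1 - q)) q := (hA _).comp_const_sub 1 q
  have hCr (q : ℝ) : HasDerivAt (fun q => C (1 - q)) (-C' (1 - q)) q := (hC _).comp_const_sub 1 q
  have cont_a : Continuous (hzeta (2 - a)) := by
    simpa [show 1 - (a - 1) = 2 - a by ring] using continuous_hzeta (show 1 < a - 1 by linarith)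
  have cont_c : Continuous (hzeta (2 - c)) := by
    simpa [show 1 - (c - 1) = 2 - c by ring] using continuous_hzeta (show 1 < c - 1 by linarith)
  have cA : Continuous A := continuous_hzeta (by linarith)
  have cC : Continuous C := continuous_hzeta (by linarith)
  have cA' : Continuous A' := by fun_prop
  have cC' : Continuous C' := by fun_prop
  have A1 : A 1 = A 0 := hzeta_apply_one _
  have C1 : C 1 = C 0 := hzeta_apply_one _
  set F : ℝ → ℝ := fun q => A q * (C q + C (1 - q)) - 2 * A 0 * C 0
  set F' : ℝ → ℝ := fun q => A' q * (C q + C (1 - q)) + A q * (C' q + -C' (1 - q))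
  set G : ℝ → ℝ := fun q => C q * (A q - A (1 - q))
  set G' : ℝ → ℝ := fun q => C' q * (A q - A (1 - q)) + C q * (A' q - -A' (1 - q))
  have hF (q : ℝ) : HasDerivAt F (F' q) q := ((hA q).mul ((hC q).add (hCr q))).sub_const _
  have hG (q : ℝ) : HasDerivAt G (G' q) q := (hC q).mul ((hA q).sub (hAr q))
  have cF' : Continuous F' := by fun_prop
  have cG' : Continuous G' := by fun_prop
  have F0 : F 0 = 0 := by simp only [F, sub_zero, C1]; ring
  have F1 : F 1 = 0 := by simp only [F, sub_self, C1, A1]; ring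
  have G0 : G 0 = 0 := by simp only [G, sub_zero, A1]; ring
  have G1 : G 1 = 0 := by simp only [G, sub_self, A1]; ring
  have hcot : ∫ q in (0 : ℝ)..1, F q * (Real.cos (π * q) / Real.sin (π * q)) =
      ∫ q in (0 : ℝ)..1, G q * (Real.cos (π * q) / Real.sin (π * q)) := by
    rw [← sub_eq_zero, ← intervalIntegral.integral_sub
      (intervalIntegrable_mul_cot hF cF' F0 F1) (intervalIntegrable_mul_cot hG cG' G0 G1)]
    simp_rw [← sub_mul]
    refine integral_mul_cot_eq_zero (H := fun q => F q - G q) fun q => ?_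
    simp only [F, G, sub_sub_cancel]
    ring
  have hS (f : ℝ → ℝ) : ∫ q in (0 : ℝ)..1, f q * S q =
      -∫ q in (0 : ℝ)..1, f q * Real.log (2 * Real.sin (π * q)) := by
    rw [← intervalIntegral.integral_neg]
    refine intervalIntegral.integral_congr_Ioo_of_le zero_le_one fun q hq => ?_
    simp only [S_eq_neg_log hq, mul_neg]
  have hint {f : ℝ → ℝ} (hf : Continuous f) : IntervalIntegrable
      (fun q => f q * Real.log (2 * Real.sin (π * q))) volume 0 1 :=
    intervalIntegrable_log_two_mul_sin_pi.continuousOn_mul hf.continuousOn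
  rw [← hcot, ← integral_deriv_mul_log_two_mul_sin_pi hF cF' F0 F1]
  have i1 := hint (f := fun q => hzeta (2 - a) q * C q) (by fun_prop)
  have i2 := hint (f := fun q => hzeta (2 - a) q * C (1 - q)) (by fun_prop)
  have i3 := hint (f := fun q => A q * hzeta (2 - c) q) (by fun_prop)
  have i4 := hint (f := fun q => A q * hzeta (2 - c) (1 - q)) (by fun_prop)
  rw [hS, hS, hS, hS]
  simp only [mul_neg, ← neg_add, sub_neg_eq_add]
  rw [← intervalIntegral.integral_const_mul, ← intervalIntegral.integral_const_mul,
    ← intervalIntegral.integral_const_mul, ← intervalIntegral.integral_const_mul,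
    ← intervalIntegral.integral_add (i1.const_mul _) (i2.const_mul _),
    ← intervalIntegral.integral_add ((i1.const_mul _).add (i2.const_mul _)) (i3.const_mul _),
    neg_add_eq_sub, ← intervalIntegral.integral_sub (i4.const_mul _)
      (((i1.const_mul _).add (i2.const_mul _)).add (i3.const_mul _))]
  refine intervalIntegral.integral_congr fun q _ => ?_
  simp only [F', A', C']
  ring
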